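/- For every α > 0 and every fixed q ∈ (0,1), one has the two-sided comparison ψ_Q(α) ≤ ψ_QD(α) ≤ q^{-1} ψ_Q(qα), i.e. α‖(αI + A*A)^{-2} A* f‖ ≤ α‖(αI + A*A)^{-1}(qαI + A*A)^{-1} A* f‖ ≤ q^{-1}·qα‖(qαI + A*A)^{-2} A* f‖. -/

import Mathlib

open MeasureTheory
open scoped RealInnerProductSpace

noncomputable section

variable {H F : Type*} [NormedAddCommGroup H] [InnerProductSpace ℝ H] [CompleteSpace H]
  [NormedAddCommGroup F] [InnerProductSpace ℝ F] [CompleteSpace F]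

/-- The inverse `(α I + A* A)⁻¹` (as `Ring.inverse`; for `α > 0` the operator
`α I + A* A` is boundedly invertible, so `Ring.inverse` is its genuine inverse). -/
def tikInv (A : H →L[ℝ] F) (α : ℝ) : H →L[ℝ] H :=
  Ring.inverse (α • (1 : H →L[ℝ] H) + (ContinuousLinearMap.adjoint A).comp A)

/-- Tikhonov approximation `u_α = (α I + A* A)⁻¹ A* f`. -/
def tikSol (A : H →L[ℝ] F) (f : F) (α : ℝ) : H :=
  tikInv A α (ContinuousLinearMap.adjoint A f)

/-- Quasi-optimality function `ψ_Q(α) = α ‖(α I + A* A)⁻² A* f‖`. -/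
def psiQ (A : H →L[ℝ] F) (f : F) (α : ℝ) : ℝ :=
  α * ‖(tikInv A α ^ 2) (ContinuousLinearMap.adjoint A f)‖

/-- Error functional `e1(α) = ‖u_α⁺ - u_*‖ + ‖u_α - u_α⁺‖`. -/
def e1 (A : H →L[ℝ] F) (f fstar : F) (ustar : H) (α : ℝ) : ℝ :=
  ‖tikSol A fstar α - ustar‖ + ‖tikSol A f α - tikSol A fstar α‖

/-- Error functional `e2(α, δ) = ‖u_α⁺ - u_*‖ + δ/(2 √α)`. -/
def e2 (A : H →L[ℝ] F) (fstar : F) (ustar : H) (δ α : ℝ) : ℝ :=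
  ‖tikSol A fstar α - ustar‖ + δ / (2 * Real.sqrt α)

/-- Modified discrepancy `d_MD(α) = ‖B_α (A u_α - f)‖` where
`B_α = α^{1/2} (α I + A A*)^{-1/2}`; since `B_α` is positive and selfadjoint,
`‖B_α w‖² = α ⟪(α I + A A*)⁻¹ w, w⟫`, which is used as the definition. -/
def dMD (A : H →L[ℝ] F) (f : F) (α : ℝ) : ℝ :=
  Real.sqrt (α * ⟪(Ring.inverse (α • (1 : F →L[ℝ] F) + A.comp (ContinuousLinearMap.adjoint A)))
      (A (tikSol A f α) - f), A (tikSol A f α) - f⟫)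

/-- `k` is a local minimum point of `j ↦ ψ(α_j)` on the grid `j = 0, …, N`:
either `k ≤ N - 1`, `ψ k < ψ (k+1)` and (`k = 0` or there is `j ≥ 1` with
`ψ k = ψ (k-1) = ⋯ = ψ (k-j+1) < ψ (k-j)`); or `k = N` and there is `j ≥ 1` with
`ψ N = ⋯ = ψ (N-j+1) < ψ (N-j)`. -/
def IsLocMinIdx (ψ : ℕ → ℝ) (N k : ℕ) : Prop :=
  (k < N ∧ ψ k < ψ (k + 1) ∧
    (k = 0 ∨ ∃ j, 1 ≤ j ∧ j ≤ k ∧ (∀ i, k - j < i → i ≤ k → ψ i = ψ k) ∧ ψ k < ψ (k - j)))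
  ∨ (k = N ∧ ∃ j, 1 ≤ j ∧ j ≤ N ∧ (∀ i, N - j < i → i ≤ N → ψ i = ψ N) ∧ ψ N < ψ (N - j))

lemma inner_regularized_self (A : H →L[ℝ] F) (a : ℝ) (x : H) :
    ⟪(a • (1 : H →L[ℝ] H) + (ContinuousLinearMap.adjoint A).comp A) x, x⟫ =
      a * ‖x‖ ^ 2 + ‖A x‖ ^ 2 := by
  simp [inner_add_left, real_inner_smul_left, ContinuousLinearMap.adjoint_inner_left]

lemma isUnit_regularized (A : H →L[ℝ] F) {a : ℝ} (ha : 0 < a) :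
    IsUnit (a • (1 : H →L[ℝ] H) + (ContinuousLinearMap.adjoint A).comp A) := by
  refine ContinuousLinearMap.isUnit_of_forall_le_norm_inner_map _ (c := ⟨a, ha.le⟩) ha fun x => ?_
  rw [inner_regularized_self]
  refine le_trans ?_ (le_abs_self _)
  change ‖x‖ ^ 2 * a ≤ _
  nlinarith [sq_nonneg ‖A x‖]

lemma regularized_tikInv_apply (A : H →L[ℝ] F) {a : ℝ} (ha : 0 < a) (y : H) :
    (a • (1 : H →L[ℝ] H) + (ContinuousLinearMap.adjoint A).comp A) (tikInv A a y) = y :=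
  congrArg (fun T : H →L[ℝ] H => T y) (Ring.mul_inverse_cancel _ (isUnit_regularized A ha))

lemma commute_tikInv (A : H →L[ℝ] F) (a b : ℝ) : Commute (tikInv A a) (tikInv A b) := by
  refine Commute.ringInverse_ringInverse ?_
  have h (c : ℝ) (T : H →L[ℝ] H) : Commute (c • (1 : H →L[ℝ] H)) T :=
    (Commute.one_left T).smul_left c
  exact (h a _).add_left ((h b _).symm.add_right (Commute.refl _))

lemma norm_tikInv_apply_le_of_le (A : H →L[ℝ] F) {a b : ℝ} (hb : 0 < b) (hab : b ≤ a) (y : H) :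
    ‖tikInv A a y‖ ≤ ‖tikInv A b y‖ := by
  rcases hab.eq_or_lt with rfl | hab
  · rfl
  have hx := regularized_tikInv_apply A hb y
  have hz := regularized_tikInv_apply A (hb.trans hab) y
  set x := tikInv A b y
  set z := tikInv A a y
  have hw : (b • (1 : H →L[ℝ] H) + (ContinuousLinearMap.adjoint A).comp A) (x - z) =
      (a - b) • z := by
    rw [map_sub, hx, ← hz]
    simp [sub_smul]
  have h := inner_regularized_self A b (x - z)
  rw [hw, real_inner_smul_left] at h
  have hinner : 0 ≤ ⟪z, x - z⟫ :=
    nonneg_of_mul_nonneg_right (h ▸ by positivity) (sub_pos.mpr hab)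
  have hsq := norm_add_sq_real z (x - z)
  rw [add_sub_cancel] at hsq
  refine (sq_le_sq₀ (norm_nonneg z) (norm_nonneg x)).mp ?_
  nlinarith [sq_nonneg ‖x - z‖]

/-- for every `α > 0` and `q ∈ (0,1)`,
`ψ_Q(α) ≤ α ‖(αI + A*A)⁻¹ (qαI + A*A)⁻¹ A* f‖ ≤ q⁻¹ · qα ‖(qαI + A*A)⁻² A* f‖`. -/
theorem psiQ_le_psiQD_le_inv_q_mul_psiQ (A : H →L[ℝ] F) (f : F)
    (q : ℝ) (hq : q ∈ Set.Ioo (0 : ℝ) 1) (α : ℝ) (hα : 0 < α) :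
    psiQ A f α ≤ α * ‖tikInv A α (tikInv A (q * α) (ContinuousLinearMap.adjoint A f))‖ ∧
    α * ‖tikInv A α (tikInv A (q * α) (ContinuousLinearMap.adjoint A f))‖ ≤
      q⁻¹ * (q * α * ‖(tikInv A (q * α) ^ 2) (ContinuousLinearMap.adjoint A f)‖) := by
  have hqα : 0 < q * α := mul_pos hq.1 hα
  have hle : q * α ≤ α := mul_le_of_le_one_left hα.le hq.2.le
  set y := ContinuousLinearMap.adjoint A f
  have hcomm : tikInv A α (tikInv A (q * α) y) = tikInv A (q * α) (tikInv A α y) :=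
    congrArg (fun T : H →L[ℝ] H => T y) (commute_tikInv A α (q * α)).eq
  constructor
  · rw [psiQ, pow_two, mul_apply_eq_comp, hcomm]
    exact mul_le_mul_of_nonneg_left (norm_tikInv_apply_le_of_le A hqα hle _) hα.le
  · rw [pow_two, mul_apply_eq_comp, mul_assoc q, inv_mul_cancel_left₀ hq.1.ne']
    exact mul_le_mul_of_nonneg_left (norm_tikInv_apply_le_of_le A hqα hle _) hα.le
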